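/- arXiv:1807.04491 — 2 statements merged into one kernel-verified Lean document; each statement's English description precedes it below -/
import Mathlib

section
/- For β ∈ (1,2) and τ ∈ (0,1/2), the map sending a bi-infinite {0,1}-sequence (s_k) to the pair (∑_{k≥1} s_{-k} β^{-k}, ∑_{k≥0} s_k (1-τ) τ^k) is injective on X_β: if two sequences in X_β have the same image under π, they are equal. -/
/-- value in `{0,1} ⊆ ℝ` of a boolean. -/
noncomputable def bval (b : Bool) : ℝ := if b then 1 else 0

/-- The open two-sided β-shift `X_β` inside `{0,1}^ℤ` (strict inequality). -/
def XBeta (β : ℝ) : Set (ℤ → Bool) :=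
  {s | ∀ i : ℤ, ∑' k : ℕ, bval (s (i - (k + 1))) * (β⁻¹) ^ (k + 1) < 1}

/-- The coding map `π(s) = (∑_{k≥1} s_{-k} β^{-k}, ∑_{k≥0} s_k (1-τ) τ^k)`. -/
noncomputable def codingMap (β τ : ℝ) (s : ℤ → Bool) : ℝ × ℝ :=
  (∑' k : ℕ, bval (s (-(k + 1 : ℕ))) * (β⁻¹) ^ (k + 1),
   ∑' k : ℕ, bval (s (k : ℤ)) * ((1 - τ) * τ ^ k))

theorem bval_nonneg (b : Bool) : 0 ≤ bval b := by cases b <;> simp [bval]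

theorem bval_le_one (b : Bool) : bval b ≤ 1 := by cases b <;> simp [bval]

theorem summable_bval_mul_pow {r : ℝ} (hr0 : 0 ≤ r) (hr1 : r < 1) (a : ℕ → Bool) :
    Summable fun k => bval (a k) * r ^ k :=
  (summable_geometric_of_lt_one hr0 hr1).of_nonneg_of_le
    (fun k => mul_nonneg (bval_nonneg _) (pow_nonneg hr0 k))
    (fun k => mul_le_of_le_one_left (pow_nonneg hr0 k) (bval_le_one _))

theorem tsum_bval_mul_pow_eq_add {r : ℝ} (hr0 : 0 ≤ r) (hr1 : r < 1) (a : ℕ → Bool) (n : ℕ) :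
    ∑' k, bval (a (n + k)) * r ^ k =
      bval (a n) + r * ∑' k, bval (a (n + 1 + k)) * r ^ k := by
  rw [(summable_bval_mul_pow hr0 hr1 fun k => a (n + k)).tsum_eq_zero_add, ← tsum_mul_left]
  simp only [add_zero, pow_zero, mul_one]
  congr 1
  refine tsum_congr fun k => ?_
  rw [show n + (k + 1) = n + 1 + k by ring]
  ring

/-- Two binary expansions in powers of `r` with the same value agree if all their tails are
less than one. -/
theorem eq_of_tsum_bval_mul_pow_eq {r : ℝ} (hr0 : 0 < r) (hr1 : r < 1) {a b : ℕ → Bool}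
    (ha : ∀ n, r * ∑' k, bval (a (n + k)) * r ^ k < 1)
    (hb : ∀ n, r * ∑' k, bval (b (n + k)) * r ^ k < 1)
    (h : ∑' k, bval (a k) * r ^ k = ∑' k, bval (b k) * r ^ k) : a = b := by
  have nonneg (c : ℕ → Bool) (n : ℕ) : 0 ≤ r * ∑' k, bval (c (n + k)) * r ^ k :=
    mul_nonneg hr0.le (tsum_nonneg fun k => mul_nonneg (bval_nonneg _) (pow_nonneg hr0.le k))
  have step (n : ℕ) (hn : ∑' k, bval (a (n + k)) * r ^ k = ∑' k, bval (b (n + k)) * r ^ k) :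
      a n = b n ∧
        ∑' k, bval (a (n + 1 + k)) * r ^ k = ∑' k, bval (b (n + 1 + k)) * r ^ k := by
    rw [tsum_bval_mul_pow_eq_add hr0.le hr1 a, tsum_bval_mul_pow_eq_add hr0.le hr1 b] at hn
    have ha1 := ha (n + 1)
    have hb1 := hb (n + 1)
    have ha0 := nonneg a (n + 1)
    have hb0 := nonneg b (n + 1)
    have hab : a n = b n := by
      by_contra hne
      have hval : bval (a n) = 0 ∧ bval (b n) = 1 ∨ bval (a n) = 1 ∧ bval (b n) = 0 := by
        cases han : a n <;> cases hbn : b n <;> simp_all [bval]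
      rcases hval with ⟨h1, h2⟩ | ⟨h1, h2⟩ <;> rw [h1, h2] at hn <;> linarith
    refine ⟨hab, mul_left_cancel₀ hr0.ne' ?_⟩
    rw [hab] at hn
    exact add_left_cancel hn
  have tails (n : ℕ) :
      ∑' k, bval (a (n + k)) * r ^ k = ∑' k, bval (b (n + k)) * r ^ k := by
    induction n with
    | zero => simpa using h
    | succ n ih => exact (step n ih).2
  exact funext fun n => (step n (tails n)).1

theorem mul_tsum_bval_mul_pow_lt_one {r : ℝ} (hr0 : 0 ≤ r) (hr : r < 1 / 2) (a : ℕ → Bool) :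
    r * ∑' k, bval (a k) * r ^ k < 1 := by
  have hr1 : r < 1 := by linarith
  have hle : ∑' k, bval (a k) * r ^ k ≤ (1 - r)⁻¹ := by
    rw [← tsum_geometric_of_lt_one hr0 hr1]
    exact (summable_bval_mul_pow hr0 hr1 a).tsum_le_tsum
      (fun k => mul_le_of_le_one_left (pow_nonneg hr0 k) (bval_le_one _))
      (summable_geometric_of_lt_one hr0 hr1)
  refine (mul_le_mul_of_nonneg_left hle hr0).trans_lt ?_
  rw [← div_eq_mul_inv, div_lt_one (by linarith)]
  linarith

theorem mul_tsum_past_lt_one {β : ℝ} {s : ℤ → Bool} (hs : s ∈ XBeta β) (n : ℕ) :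
    β⁻¹ * ∑' k : ℕ, bval (s (-((n + k : ℕ) + 1 : ℕ))) * β⁻¹ ^ k < 1 := by
  rw [← tsum_mul_left]
  convert hs (-n) using 1
  refine tsum_congr fun k => ?_
  rw [show (-((n + k : ℕ) + 1 : ℕ) : ℤ) = -n - (k + 1) by push_cast; ring]
  ring

/-- For `β ∈ (1,2)` and `τ ∈ (0,1/2)` the coding map is injective on `X_β`. -/
theorem stmt2 (β τ : ℝ) (hβ : 1 < β) (hβ2 : β < 2) (hτ0 : 0 < τ) (hτ : τ < 1 / 2)
    (s t : ℤ → Bool) (hs : s ∈ XBeta β) (ht : t ∈ XBeta β)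
    (heq : codingMap β τ s = codingMap β τ t) : s = t := by
  have hr0 : 0 < β⁻¹ := by positivity
  have hr1 : β⁻¹ < 1 := inv_lt_one_of_one_lt₀ hβ
  obtain ⟨hpast, hfuture⟩ := Prod.ext_iff.1 heq
  have past : (fun k : ℕ => s (-(k + 1 : ℕ))) = fun k : ℕ => t (-(k + 1 : ℕ)) := by
    refine eq_of_tsum_bval_mul_pow_eq hr0 hr1 (mul_tsum_past_lt_one hs)
      (mul_tsum_past_lt_one ht) (mul_left_cancel₀ hr0.ne' ?_)
    simpa only [codingMap, pow_succ', mul_left_comm _ β⁻¹, tsum_mul_left] using hpast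
  have future : (fun k : ℕ => s k) = fun k : ℕ => t k := by
    refine eq_of_tsum_bval_mul_pow_eq hτ0 (by linarith)
      (fun n => mul_tsum_bval_mul_pow_lt_one hτ0.le hτ fun k => s (n + k : ℕ))
      (fun n => mul_tsum_bval_mul_pow_lt_one hτ0.le hτ fun k => t (n + k : ℕ))
      (mul_left_cancel₀ (sub_pos.2 (by linarith : τ < 1)).ne' ?_)
    simpa only [codingMap, mul_left_comm _ (1 - τ), tsum_mul_left] using hfuture
  funext i
  obtain ⟨n, rfl | rfl⟩ := i.eq_nat_or_neg
  · exact congrFun future n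
  · cases n with
    | zero => simpa using congrFun future 0
    | succ n => exact congrFun past n
end

section
/- There exists an f-ergodic Borel probability measure ν on Λ_{β,τ} with metric entropy h(f,ν) = log β, i.e. a measure of maximal entropy. -/
open MeasureTheory Set Filter

/-- The skew map `f` on `[0,1]²`. -/
noncomputable def skewMap (β τ : ℝ) (p : ℝ × ℝ) : ℝ × ℝ :=
  if p.1 ≤ β⁻¹ then (β * p.1, τ * p.2) else (β * p.1 - 1, τ * p.2 + (1 - τ))

/-- The attractor `Λ_{β,τ} = closure(⋂_{i≥0} f^i([0,1]²))`. -/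
noncomputable def attractor (β τ : ℝ) : Set (ℝ × ℝ) :=
  closure (⋂ i : ℕ, (skewMap β τ)^[i] '' (Icc (0:ℝ) 1 ×ˢ Icc (0:ℝ) 1))

/-- Shannon entropy of a measure on a finite type. -/
noncomputable def finEntropy {α : Type*} [Fintype α] [MeasurableSpace α] (ν : Measure α) : ℝ :=
  -∑ a : α, (ν {a}).toReal * Real.log (ν {a}).toReal

/-- Entropy of the process generated by a finite-valued observable `p` under `T`:
`lim (1/n) H(p, p∘T, …, p∘T^{n-1})` (as a `liminf`). -/
noncomputable def obsEntropy {X : Type*} [MeasurableSpace X] (μ : Measure X) (T : X → X)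
    {m : ℕ} (p : X → Fin m) : ℝ :=
  liminf (fun n : ℕ => finEntropy (α := Fin n → Fin m) (μ.map (fun x => fun i : Fin n => p (T^[(i : ℕ)] x))) / n)
    atTop

/-- Kolmogorov–Sinai (metric) entropy: supremum over measurable finite-valued observables. -/
noncomputable def metricEntropy {X : Type*} [MeasurableSpace X] (μ : Measure X)
    (T : X → X) : ℝ :=
  sSup {h : ℝ | ∃ (m : ℕ) (p : X → Fin m), Measurable p ∧ h = obsEntropy μ T p}

/-- The greedy-type digit of the `β`-transformation. -/
noncomputable def betaDigit (β x : ℝ) : Fin 2 := if x ≤ β⁻¹ then 0 else 1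

/-- The real value of `betaDigit`. -/
noncomputable def betaDigitVal (β x : ℝ) : ℝ := if x ≤ β⁻¹ then 0 else 1

/-- The `β`-transformation, with the value `1` at the discontinuity `β⁻¹`. -/
noncomputable def betaMap (β x : ℝ) : ℝ := β * x - betaDigitVal β x

/-- The first `n` digits of the `β`-expansion of `x`. -/
noncomputable def betaWord (β : ℝ) (n : ℕ) (x : ℝ) : Fin n → Fin 2 :=
  fun i => betaDigit β ((betaMap β)^[i] x)

lemma betaDigitVal_eq_of_betaDigit_eq {β x y : ℝ} (h : betaDigit β x = betaDigit β y) :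
    betaDigitVal β x = betaDigitVal β y := by
  unfold betaDigit at h
  unfold betaDigitVal
  split_ifs at h ⊢ <;> simp_all

lemma skewMap_eq (β τ : ℝ) (p : ℝ × ℝ) :
    skewMap β τ p = (betaMap β p.1, τ * p.2 + (1 - τ) * betaDigitVal β p.1) := by
  unfold skewMap betaMap betaDigitVal
  split_ifs <;> simp

lemma measurable_betaDigit (β : ℝ) : Measurable (betaDigit β) :=
  Measurable.ite measurableSet_Iic measurable_const measurable_const

lemma measurable_betaDigitVal (β : ℝ) : Measurable (betaDigitVal β) :=
  Measurable.ite measurableSet_Iic measurable_const measurable_const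

lemma measurable_betaMap (β : ℝ) : Measurable (betaMap β) :=
  (measurable_const.mul measurable_id).sub (measurable_betaDigitVal β)

lemma measurable_skewMap (β τ : ℝ) : Measurable (skewMap β τ) := by
  rw [funext (skewMap_eq β τ)]
  have h1 := measurable_betaMap β
  have h2 := measurable_betaDigitVal β
  fun_prop

lemma measurable_betaWord (β : ℝ) (n : ℕ) : Measurable (betaWord β n) :=
  measurable_pi_lambda _ fun i =>
    (measurable_betaDigit β).comp ((measurable_betaMap β).iterate i)

lemma fst_skewMap_iterate (β τ : ℝ) (n : ℕ) (p : ℝ × ℝ) :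
    ((skewMap β τ)^[n] p).1 = (betaMap β)^[n] p.1 := by
  have h : Function.Semiconj Prod.fst (skewMap β τ) (betaMap β) := fun p => by
    rw [skewMap_eq]
  exact h.iterate_right n p

lemma betaWord_succ (β : ℝ) (n : ℕ) (x : ℝ) :
    betaWord β (n + 1) x = Fin.cons (betaDigit β x) (betaWord β n (betaMap β x)) := by
  funext i
  refine Fin.cases ?_ (fun j => ?_) i
  · simp [betaWord]
  · simp [betaWord]

section

variable {β : ℝ}

lemma betaDigitVal_nonneg (x : ℝ) : 0 ≤ betaDigitVal β x := by
  unfold betaDigitVal; split_ifs <;> norm_num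

lemma betaDigitVal_le_one (x : ℝ) : betaDigitVal β x ≤ 1 := by
  unfold betaDigitVal; split_ifs <;> norm_num

lemma betaMap_mem (hβ : 1 < β) (hβ2 : β < 2) {x : ℝ} (hx : x ∈ Ioc (0 : ℝ) 1) :
    betaMap β x ∈ Ioc (0 : ℝ) 1 := by
  have h0 : (0 : ℝ) < β := by linarith
  unfold betaMap betaDigitVal
  split_ifs with h
  · have := mul_le_mul_of_nonneg_left h h0.le
    rw [mul_inv_cancel₀ h0.ne'] at this
    exact ⟨by have := mul_pos h0 hx.1; linarith, by linarith⟩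
  · have := mul_lt_mul_of_pos_left (not_le.1 h) h0
    rw [mul_inv_cancel₀ h0.ne'] at this
    have h3 := mul_le_mul_of_nonneg_left hx.2 h0.le
    exact ⟨by linarith, by linarith⟩

lemma betaMap_iterate_mem (hβ : 1 < β) (hβ2 : β < 2) {x : ℝ} (hx : x ∈ Ioc (0 : ℝ) 1) (n : ℕ) :
    (betaMap β)^[n] x ∈ Ioc (0 : ℝ) 1 := by
  induction n with
  | zero => exact hx
  | succ n ih => rw [Function.iterate_succ_apply']; exact betaMap_mem hβ hβ2 ih

lemma betaMap_iterate_sub {n : ℕ} {x y : ℝ} (h : betaWord β n x = betaWord β n y) {k : ℕ}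
    (hk : k ≤ n) : (betaMap β)^[k] x - (betaMap β)^[k] y = β ^ k * (x - y) := by
  induction k with
  | zero => simp
  | succ k ih =>
    have h1 := betaDigitVal_eq_of_betaDigit_eq (congrFun h ⟨k, hk⟩)
    simp only at h1
    rw [Function.iterate_succ_apply', Function.iterate_succ_apply', pow_succ']
    unfold betaMap at h1 ⊢
    rw [h1]
    have := ih (by omega)
    unfold betaMap at this
    linear_combination β * this

lemma abs_sub_le_of_betaWord_eq (hβ : 1 < β) (hβ2 : β < 2) {n : ℕ} {x y : ℝ}
    (hx : x ∈ Ioc (0 : ℝ) 1) (hy : y ∈ Ioc (0 : ℝ) 1) (h : betaWord β n x = betaWord β n y)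
    {k : ℕ} (hk : k ≤ n) : |(betaMap β)^[k] x - (betaMap β)^[k] y| ≤ (β⁻¹) ^ (n - k) := by
  have h0 : (0 : ℝ) < β := by linarith
  have hx' := betaMap_iterate_mem hβ hβ2 hx n
  have hy' := betaMap_iterate_mem hβ hβ2 hy n
  have h1 : |(betaMap β)^[n] x - (betaMap β)^[n] y| ≤ 1 := by
    rw [abs_le]; constructor <;> linarith [hx'.1, hx'.2, hy'.1, hy'.2]
  rw [betaMap_iterate_sub h le_rfl, abs_mul, abs_of_pos (by positivity)] at h1
  rw [betaMap_iterate_sub h hk, abs_mul, abs_of_pos (by positivity), inv_pow,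
    ← one_div, le_div_iff₀ (by positivity)]
  calc β ^ k * |x - y| * β ^ (n - k) = β ^ (n - k + k) * |x - y| := by rw [pow_add]; ring
    _ ≤ 1 := by rwa [Nat.sub_add_cancel hk]

/-- The number of admissible words grows at most like `β ^ n`. -/
lemma ncard_betaWord_image_le (hβ : 1 < β) (hβ2 : β < 2) (n : ℕ) {a : ℝ}
    (ha : a ∈ Ioc (0 : ℝ) 1) :
    ((betaWord β n '' Ioc 0 a).ncard : ℝ) ≤ (β * (β ^ n - 1) / (β - 1)) * a + 1 := by
  have h0 : (0 : ℝ) < β := by linarith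
  have h1 : (0 : ℝ) < β - 1 := by linarith
  induction n generalizing a with
  | zero =>
    have : (betaWord β 0 '' Ioc 0 a).ncard ≤ 1 := Set.ncard_le_one_of_subsingleton _
    simpa using this
  | succ n ih =>
    set K := β * (β ^ n - 1) / (β - 1) with hK
    have hK' : β * (β ^ (n + 1) - 1) / (β - 1) = β * (K + 1) := by
      rw [hK]; field_simp; ring
    rw [hK']
    have hT := ih (betaMap_mem hβ hβ2 ha)
    by_cases h : a ≤ β⁻¹
    · have hsub : betaWord β (n + 1) '' Ioc 0 a ⊆
          Fin.cons (α := fun _ => Fin 2) 0 '' (betaWord β n '' Ioc 0 (betaMap β a)) := by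
        rintro _ ⟨x, hx, rfl⟩
        have hx1 : x ≤ β⁻¹ := hx.2.trans h
        refine ⟨_, ⟨betaMap β x, ?_, rfl⟩, ?_⟩
        · simp only [betaMap, betaDigitVal, if_pos h, if_pos hx1, sub_zero]
          exact ⟨mul_pos h0 hx.1, by gcongr; exact hx.2⟩
        · rw [betaWord_succ]; simp [betaDigit, hx1]
      have h2 : (betaWord β (n + 1) '' Ioc 0 a).ncard ≤ (betaWord β n '' Ioc 0 (betaMap β a)).ncard :=
        (Set.ncard_le_ncard hsub (Set.toFinite _)).trans (Set.ncard_image_le (Set.toFinite _))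
      have h3 : betaMap β a = β * a := by simp [betaMap, betaDigitVal, h]
      have h4 : ((betaWord β (n + 1) '' Ioc 0 a).ncard : ℝ) ≤ K * (β * a) + 1 := by
        rw [← h3]; exact le_trans (by exact_mod_cast h2) hT
      nlinarith [mul_pos h0 ha.1]
    · have hsub : betaWord β (n + 1) '' Ioc 0 a ⊆
          Fin.cons (α := fun _ => Fin 2) 0 '' (betaWord β n '' Ioc 0 1) ∪
          Fin.cons (α := fun _ => Fin 2) 1 '' (betaWord β n '' Ioc 0 (betaMap β a)) := by
        rintro _ ⟨x, hx, rfl⟩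
        have hm := betaMap_mem hβ hβ2 ⟨hx.1, hx.2.trans ha.2⟩
        by_cases hx1 : x ≤ β⁻¹
        · refine Or.inl ⟨_, ⟨betaMap β x, hm, rfl⟩, ?_⟩
          rw [betaWord_succ]; simp [betaDigit, hx1]
        · refine Or.inr ⟨_, ⟨betaMap β x, ⟨hm.1, ?_⟩, rfl⟩, ?_⟩
          · simp only [betaMap, betaDigitVal, if_neg h, if_neg hx1]
            gcongr; exact hx.2
          · rw [betaWord_succ]; simp [betaDigit, hx1]
      have h2 : (betaWord β (n + 1) '' Ioc 0 a).ncard ≤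
          (betaWord β n '' Ioc 0 1).ncard + (betaWord β n '' Ioc 0 (betaMap β a)).ncard :=
        (Set.ncard_le_ncard hsub (Set.toFinite _)).trans ((Set.ncard_union_le _ _).trans
          (add_le_add (Set.ncard_image_le (Set.toFinite _)) (Set.ncard_image_le (Set.toFinite _))))
      have h3 : betaMap β a = β * a - 1 := by simp [betaMap, betaDigitVal, h]
      have h5 := ih (a := 1) (by simp)
      rw [h3] at hT h2
      have h4 : ((betaWord β (n + 1) '' Ioc 0 a).ncard : ℝ) ≤ (K * 1 + 1) + (K * (β * a - 1) + 1) :=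
        le_trans (by exact_mod_cast h2) (add_le_add h5 hT)
      have := mul_lt_mul_of_pos_left (not_le.1 h) h0
      rw [mul_inv_cancel₀ h0.ne'] at this
      linarith

end

lemma map_affine_restrict_Ioc {β : ℝ} (hβ : 0 < β) (u v c : ℝ) :
    (volume.restrict (Ioc u v)).map (fun x => β * x - c) =
      ENNReal.ofReal β⁻¹ • volume.restrict (Ioc (β * u - c) (β * v - c)) := by
  have hm : Measurable fun x : ℝ => β * x - c := by fun_prop
  have h1 : (volume : Measure ℝ).map (fun x => β * x - c) = ENNReal.ofReal β⁻¹ • volume := by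
    have h2 : (fun x : ℝ => β * x - c) = (fun x => x - c) ∘ (fun x => β * x) := rfl
    rw [h2, ← Measure.map_map (by fun_prop) (by fun_prop), Real.map_volume_mul_left hβ.ne',
      Measure.map_smul, map_sub_right_eq_self, abs_of_pos (by positivity)]
  have h3 : (fun x : ℝ => β * x - c) ⁻¹' Ioc (β * u - c) (β * v - c) = Ioc u v := by
    ext x
    simp [mem_Ioc, hβ]
  rw [← Measure.restrict_smul, ← h1, Measure.restrict_map hm measurableSet_Ioc, h3]

lemma map_skewMap_prod_of_digit_eq {β : ℝ} (hβ : 0 < β) (τ : ℝ) {u v c : ℝ}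
    (h : ∀ x ∈ Ioc u v, betaDigitVal β x = c) (κ : Measure ℝ) [IsProbabilityMeasure κ] :
    ((volume.restrict (Ioc u v)).prod κ).map (skewMap β τ) =
      ENNReal.ofReal β⁻¹ • (volume.restrict (Ioc (β * u - c) (β * v - c))).prod
        (κ.map fun y => τ * y + (1 - τ) * c) := by
  have h1 : ∀ᵐ p ∂((volume.restrict (Ioc u v)).prod κ), p.1 ∈ Ioc u v :=
    Measure.quasiMeasurePreserving_fst.ae (ae_restrict_mem measurableSet_Ioc)
  have h2 : skewMap β τ =ᵐ[(volume.restrict (Ioc u v)).prod κ]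
      Prod.map (fun x => β * x - c) (fun y => τ * y + (1 - τ) * c) := by
    filter_upwards [h1] with p hp
    rw [skewMap_eq, betaMap, h _ hp]
    rfl
  rw [Measure.map_congr h2, ← Measure.map_prod_map _ _ (by fun_prop) (by fun_prop),
    map_affine_restrict_Ioc hβ, Measure.prod_smul_left]

lemma map_skewMap_prod {β : ℝ} (hβ : 1 < β) (τ a : ℝ) (κ : Measure ℝ) [IsProbabilityMeasure κ] :
    ((volume.restrict (Ioc 0 a)).prod κ).map (skewMap β τ) =
      ENNReal.ofReal β⁻¹ • ((volume.restrict (Ioc 0 (betaMap β a))).prod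
          (κ.map fun y => τ * y + (1 - τ) * betaDigitVal β a) +
        ENNReal.ofReal (betaDigitVal β a) • (volume.restrict (Ioc 0 1)).prod
          (κ.map fun y => τ * y)) := by
  have h0 : 0 < β := by linarith
  by_cases h : a ≤ β⁻¹
  · have h1 := map_skewMap_prod_of_digit_eq h0 τ (u := 0) (v := a) (c := 0)
      (fun x hx => if_pos (hx.2.trans h)) κ
    rw [h1]
    simp [betaMap, betaDigitVal, h]
  · have hlt := not_le.1 h
    have h1 := map_skewMap_prod_of_digit_eq h0 τ (u := 0) (v := β⁻¹) (c := 0)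
      (fun x hx => if_pos hx.2) κ
    have h2 := map_skewMap_prod_of_digit_eq h0 τ (u := β⁻¹) (v := a) (c := 1)
      (fun x hx => if_neg (not_le.2 hx.1)) κ
    have h3 : volume.restrict (Ioc 0 a) =
        volume.restrict (Ioc 0 β⁻¹) + volume.restrict (Ioc β⁻¹ a) := by
      rw [← Measure.restrict_union (Ioc_disjoint_Ioc_of_le le_rfl) measurableSet_Ioc,
        Ioc_union_Ioc_eq_Ioc (by positivity) hlt.le]
    rw [h3, Measure.add_prod, Measure.map_add _ _ (measurable_skewMap β τ), h1, h2,
      ← smul_add, add_comm]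
    simp [betaMap, betaDigitVal, h, h0.ne']

lemma map_betaMap_restrict {β : ℝ} (hβ : 1 < β) (a : ℝ) :
    (volume.restrict (Ioc 0 a)).map (betaMap β) =
      ENNReal.ofReal β⁻¹ • (volume.restrict (Ioc 0 (betaMap β a)) +
        ENNReal.ofReal (betaDigitVal β a) • volume.restrict (Ioc 0 1)) := by
  have h1 := congrArg (Measure.map Prod.fst) (map_skewMap_prod hβ 0 a (Measure.dirac 0))
  have hc : Prod.fst ∘ skewMap β 0 = betaMap β ∘ Prod.fst := by
    funext p; simp [skewMap_eq]
  have hp (g : ℝ → ℝ) (hg : Measurable g) : IsProbabilityMeasure ((Measure.dirac (0 : ℝ)).map g) :=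
    Measure.isProbabilityMeasure_map hg.aemeasurable
  have := hp (fun y => 0 * y + (1 - 0) * betaDigitVal β a) (by fun_prop)
  have := hp (fun y => 0 * y) (by fun_prop)
  rw [Measure.map_map measurable_fst (measurable_skewMap β 0), hc,
    ← Measure.map_map (measurable_betaMap β) measurable_fst, Measure.map_smul,
    Measure.map_add _ _ measurable_fst, Measure.map_smul] at h1
  simpa only [Measure.map_fst_prod, measure_univ, one_smul] using h1

lemma measureReal_inter_Ioc_of_preimage_eq {β : ℝ} (hβ : 1 < β) (hβ2 : β < 2) {B : Set ℝ}
    (hB : MeasurableSet B) (hinv : betaMap β ⁻¹' B = B) {a : ℝ} (ha : a ∈ Ioc (0 : ℝ) 1) :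
    volume.real (B ∩ Ioc 0 a) = a * volume.real (B ∩ Ioc 0 1) := by
  have h0 : 0 < β := by linarith
  set F : ℝ → ℝ := fun a => volume.real (B ∩ Ioc 0 a) with hF
  have hrec (a : ℝ) : β * F a = F (betaMap β a) + betaDigitVal β a * F 1 := by
    have h1 := congrArg (fun μ : Measure ℝ => μ.real B) (map_betaMap_restrict hβ a)
    rw [map_measureReal_apply (measurable_betaMap β) hB, hinv, measureReal_ennreal_smul_apply,
      measureReal_add_apply (h₂ := ENNReal.mul_ne_top ENNReal.ofReal_ne_top (measure_ne_top _ _)),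
      measureReal_ennreal_smul_apply,
      measureReal_restrict_apply hB, measureReal_restrict_apply hB, measureReal_restrict_apply hB,
      ENNReal.toReal_ofReal (by positivity), ENNReal.toReal_ofReal (betaDigitVal_nonneg a)] at h1
    change F a = β⁻¹ * (F (betaMap β a) + betaDigitVal β a * F 1) at h1
    rw [h1]
    field_simp
  set G : ℝ → ℝ := fun a => F a - a * F 1 with hG
  have hrecG (a : ℝ) : β * G a = G (betaMap β a) := by
    have := hrec a
    simp only [hG, betaMap] at this ⊢
    linear_combination this
  have hiter (n : ℕ) : β ^ n * G a = G ((betaMap β)^[n] a) := by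
    induction n with
    | zero => simp
    | succ n ih =>
      rw [Function.iterate_succ_apply', ← hrecG, ← ih]
      ring
  have hF1 {a : ℝ} (ha : a ∈ Ioc (0 : ℝ) 1) : F a ≤ 1 := by
    calc F a ≤ volume.real (Ioc (0 : ℝ) a) := measureReal_mono inter_subset_right (by simp)
      _ ≤ 1 := by simp [ha.1.le, ha.2]
  have hF0 (a : ℝ) : 0 ≤ F a := measureReal_nonneg
  have hGb {a : ℝ} (ha : a ∈ Ioc (0 : ℝ) 1) : |G a| ≤ 1 := by
    have h1 := hF1 ha
    have h2 := hF1 (a := 1) (by simp)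
    have h3 := hF0 a
    have h4 := hF0 1
    rw [abs_le]
    simp only [hG]
    constructor <;> nlinarith [ha.1, ha.2]
  have hb (n : ℕ) : β ^ n * |G a| ≤ 1 := by
    rw [← abs_of_pos (pow_pos h0 n), ← abs_mul, hiter]
    exact hGb (betaMap_iterate_mem hβ hβ2 ha n)
  have hGa : G a = 0 := by
    by_contra hne
    obtain ⟨n, hn⟩ := pow_unbounded_of_one_lt (1 / |G a|) hβ
    rw [div_lt_iff₀ (abs_pos.2 hne)] at hn
    exact absurd (hb n) (not_le.2 hn)
  simp only [hG] at hGa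
  linarith

lemma ergodic_betaMap {β : ℝ} (hβ : 1 < β) (hβ2 : β < 2) {μ : Measure ℝ}
    (hpres : MeasurePreserving (betaMap β) μ μ) (hμ : μ ≪ volume.restrict (Ioc 0 1)) :
    Ergodic (betaMap β) μ := by
  refine ⟨hpres, ⟨fun B hB hinv => ?_⟩⟩
  set ρ : Measure ℝ := volume.restrict (Ioc 0 1) with hρ
  have hfin : IsFiniteMeasure (ρ.restrict B) := inferInstance
  have hkey : ρ.restrict B = ENNReal.ofReal (volume.real (B ∩ Ioc 0 1)) • ρ := by
    refine Measure.ext_of_Iic _ _ fun t => ?_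
    rw [Measure.restrict_apply measurableSet_Iic, Measure.smul_apply, hρ,
      Measure.restrict_apply (measurableSet_Iic.inter hB),
      Measure.restrict_apply measurableSet_Iic]
    rcases le_or_gt t 0 with ht | ht
    · have h1 : Iic t ∩ Ioc (0 : ℝ) 1 = ∅ := by
        ext x; simp only [mem_inter_iff, mem_Iic, mem_Ioc, mem_empty_iff_false, iff_false]
        rintro ⟨h, h', -⟩; linarith
      have h2 : Iic t ∩ B ∩ Ioc (0 : ℝ) 1 = ∅ := by
        rw [inter_right_comm, h1, empty_inter]
      rw [h1, h2]; simp
    · have hs : min t 1 ∈ Ioc (0 : ℝ) 1 := ⟨lt_min ht one_pos, min_le_right _ _⟩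
      have h1 : Iic t ∩ Ioc (0 : ℝ) 1 = Ioc 0 (min t 1) := by
        ext x; simp only [mem_inter_iff, mem_Iic, mem_Ioc, le_min_iff]; tauto
      have h2 : Iic t ∩ B ∩ Ioc (0 : ℝ) 1 = B ∩ Ioc 0 (min t 1) := by
        rw [inter_right_comm, h1, inter_comm]
      have h3 := measureReal_inter_Ioc_of_preimage_eq hβ hβ2 hB hinv hs
      have h4 : volume (B ∩ Ioc 0 (min t 1)) ≠ ⊤ :=
        measure_ne_top_of_subset inter_subset_right (by simp)
      rw [h1, h2, ← ENNReal.ofReal_toReal h4, ← measureReal_def, h3, mul_comm,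
        ENNReal.ofReal_mul measureReal_nonneg, Real.volume_Ioc, sub_zero, smul_eq_mul]
  have h1 := congrArg (fun μ : Measure ℝ => μ Bᶜ) hkey
  simp only [Measure.restrict_apply hB.compl, compl_inter_self, measure_empty,
    Measure.smul_apply, smul_eq_mul] at h1
  rw [eventuallyConst_set']
  rcases mul_eq_zero.1 h1.symm with h2 | h2
  · left
    have h3 : ρ B = 0 := by
      have := congrArg (fun μ : Measure ℝ => μ B) hkey
      simpa [h2] using this
    exact eventuallyEq_empty.2 (measure_eq_zero_iff_ae_notMem.1 (hμ h3))
  · right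
    exact eventuallyEq_univ.2 (mem_ae_iff.2 (hμ h2))

lemma infinitePi_eq_map_cons {X : Type*} [MeasurableSpace X] (P : Measure X)
    [IsProbabilityMeasure P] :
    Measure.infinitePi (fun _ : ℕ => P) =
      (P.prod (Measure.infinitePi fun _ : ℕ => P)).map
        (fun q i => Nat.casesOn (motive := fun _ => X) i q.1 q.2) := by
  classical
  have hm : Measurable fun (q : X × (ℕ → X)) (i : ℕ) =>
      Nat.casesOn (motive := fun _ => X) i q.1 q.2 := by
    refine measurable_pi_lambda _ fun i => ?_
    cases i with
    | zero => exact measurable_fst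
    | succ i => exact (measurable_pi_apply i).comp measurable_snd
  refine (Measure.eq_infinitePi _ fun s t ht => ?_).symm
  set u : ℕ → Set X := fun i => if i ∈ s then t i else univ with hu
  have hum (i : ℕ) : MeasurableSet (u i) := by
    simp only [hu]; split_ifs
    · exact ht i
    · exact .univ
  have hsub : s ⊆ Finset.range (s.sup id + 1) := s.subset_range_sup_succ
  set n := s.sup id
  have h1 : Set.pi (s : Set ℕ) t = Set.pi (Finset.range (n + 1) : Set ℕ) u := by
    ext ω
    simp only [Set.mem_pi, hu]
    refine ⟨fun h i _ => ?_, fun h i hi => ?_⟩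
    · split_ifs with hi
      · exact h i hi
      · trivial
    · have := h i (hsub hi)
      rwa [if_pos (by exact_mod_cast hi)] at this
  have h2 : ∏ i ∈ s, P (t i) = ∏ i ∈ Finset.range (n + 1), P (u i) := by
    rw [← Finset.prod_subset hsub (f := fun i => P (u i))]
    · exact Finset.prod_congr rfl fun i hi => by simp [hu, hi]
    · intro i _ hi; simp [hu, hi]
  have h3 : (fun (q : X × (ℕ → X)) (i : ℕ) => Nat.casesOn (motive := fun _ => X) i q.1 q.2) ⁻¹'
      Set.pi (Finset.range (n + 1) : Set ℕ) u =
      u 0 ×ˢ Set.pi (Finset.range n : Set ℕ) (fun i => u (i + 1)) := by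
    ext q
    simp only [mem_preimage, Set.mem_pi, Finset.coe_range, mem_Iio, mem_prod]
    refine ⟨fun h => ⟨h 0 (by omega), fun i hi => h (i + 1) (by omega)⟩, fun h i hi => ?_⟩
    cases i with
    | zero => exact h.1
    | succ i => exact h.2 i (by omega)
  rw [h1, h2, Measure.map_apply hm (.pi (Finset.countable_toSet _) fun i _ => hum i), h3,
    Measure.prod_prod, Measure.infinitePi_pi _ fun i _ => hum (i + 1), Finset.prod_range_succ',
    mul_comm]

/-- A countable family of increasing self-maps of `[0, 1]`, chosen at random with probabilities
`p n`, has a stationary probability measure. -/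
lemma exists_stationary_measure {p : ℕ → ENNReal} (hp : ∑' n, p n = 1) {G : ℕ → ℝ → ℝ}
    (hcont : ∀ n, Continuous (G n)) (hmono : ∀ n, Monotone (G n))
    (hmaps : ∀ n, MapsTo (G n) (Icc 0 1) (Icc 0 1)) :
    ∃ κ : Measure ℝ, IsProbabilityMeasure κ ∧ κ (Icc 0 1)ᶜ = 0 ∧
      κ = Measure.sum fun n => p n • κ.map (G n) := by
  set P : Measure ℕ := Measure.sum fun n => p n • Measure.dirac n with hP
  have : IsProbabilityMeasure P := ⟨by simp [hP, hp]⟩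
  set Q := Measure.infinitePi fun _ : ℕ => P with hQ
  let Z : ℕ → (ℕ → ℕ) → ℝ := fun k =>
    Nat.rec (fun _ => 0) (fun _ Zk ω => G (ω 0) (Zk fun i => ω (i + 1))) k
  have hZs (k : ℕ) (ω : ℕ → ℕ) : Z (k + 1) ω = G (ω 0) (Z k fun i => ω (i + 1)) := rfl
  have hGm : Measurable fun q : ℕ × ℝ => G q.1 q.2 :=
    measurable_from_prod_countable_right fun n => (hcont n).measurable
  have hZm (k : ℕ) : Measurable (Z k) := by
    induction k with
    | zero => exact measurable_const
    | succ k ih =>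
      have hs : Measurable fun (ω : ℕ → ℕ) (i : ℕ) => ω (i + 1) := by fun_prop
      have h0 : Measurable fun ω : ℕ → ℕ => ω 0 := measurable_pi_apply 0
      exact hGm.comp (h0.prodMk (ih.comp hs))
  have hZmem (k : ℕ) (ω : ℕ → ℕ) : Z k ω ∈ Icc (0 : ℝ) 1 := by
    induction k generalizing ω with
    | zero => exact ⟨le_rfl, zero_le_one⟩
    | succ k ih => exact hmaps _ (ih _)
  have hZle (k : ℕ) (ω : ℕ → ℕ) : Z k ω ≤ Z (k + 1) ω := by
    induction k generalizing ω with
    | zero => exact (hZmem 1 ω).1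
    | succ k ih => exact hmono _ (ih _)
  have hbdd (ω : ℕ → ℕ) : BddAbove (range fun k => Z k ω) :=
    ⟨1, by rintro _ ⟨k, rfl⟩; exact (hZmem k ω).2⟩
  set Y : (ℕ → ℕ) → ℝ := fun ω => ⨆ k, Z k ω with hY
  have hYm : Measurable Y := Measurable.iSup hZm
  have hlim (ω : ℕ → ℕ) : Tendsto (fun k => Z k ω) atTop (nhds (Y ω)) :=
    tendsto_atTop_ciSup (monotone_nat_of_le_succ fun k => hZle k ω) (hbdd ω)
  have hYmem (ω : ℕ → ℕ) : Y ω ∈ Icc (0 : ℝ) 1 :=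
    isClosed_Icc.mem_of_tendsto (hlim ω) (.of_forall fun k => hZmem k ω)
  have hYs (ω : ℕ → ℕ) : Y ω = G (ω 0) (Y fun i => ω (i + 1)) := by
    refine tendsto_nhds_unique ((tendsto_add_atTop_iff_nat 1).2 (hlim ω)) ?_
    simp only [hZs]
    exact ((hcont _).tendsto _).comp (hlim _)
  refine ⟨Q.map Y, Measure.isProbabilityMeasure_map hYm.aemeasurable, ?_, ?_⟩
  · rw [Measure.map_apply hYm measurableSet_Icc.compl]
    convert measure_empty (μ := Q)
    ext ω
    simpa using hYmem ω
  · have hc : Measurable fun (q : ℕ × (ℕ → ℕ)) (i : ℕ) =>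
        Nat.casesOn (motive := fun _ => ℕ) i q.1 q.2 := by
      refine measurable_pi_lambda _ fun i => ?_
      cases i with
      | zero => exact measurable_fst
      | succ i => exact (measurable_pi_apply i).comp measurable_snd
    have h1 : Q.map Y = (P.prod Q).map fun q => G q.1 (Y q.2) := by
      conv_lhs => rw [hQ, infinitePi_eq_map_cons P, Measure.map_map hYm hc]
      congr 1
      funext q
      exact hYs _
    have hm2 : Measurable fun q : ℕ × (ℕ → ℕ) => G q.1 (Y q.2) :=
      hGm.comp (measurable_fst.prodMk (hYm.comp measurable_snd))
    conv_lhs => rw [h1, hP, Measure.prod_sum_left, Measure.map_sum hm2.aemeasurable]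
    congr 1
    funext n
    rw [Measure.prod_smul_left, Measure.dirac_prod, Measure.map_smul,
      Measure.map_map hm2 (by fun_prop), Measure.map_map (hcont n).measurable hYm]
    rfl

lemma hasSum_betaDigitVal {β : ℝ} (hβ : 1 < β) (hβ2 : β < 2) :
    HasSum (fun n => betaDigitVal β ((betaMap β)^[n] 1) * (β⁻¹) ^ (n + 1)) 1 := by
  have h0 : 0 < β := by linarith
  have hd (n : ℕ) : 0 ≤ betaDigitVal β ((betaMap β)^[n] 1) * (β⁻¹) ^ (n + 1) :=
    mul_nonneg (betaDigitVal_nonneg _) (by positivity)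
  rw [hasSum_iff_tendsto_nat_of_nonneg hd]
  have hs (n : ℕ) : ∑ i ∈ Finset.range n, betaDigitVal β ((betaMap β)^[i] 1) * (β⁻¹) ^ (i + 1) =
      1 - (β⁻¹) ^ n * (betaMap β)^[n] 1 := by
    induction n with
    | zero => simp
    | succ n ih =>
      rw [Finset.sum_range_succ, ih, Function.iterate_succ_apply']
      have h1 : betaMap β ((betaMap β)^[n] 1) =
          β * (betaMap β)^[n] 1 - betaDigitVal β ((betaMap β)^[n] 1) := rfl
      rw [h1, pow_succ]
      field_simp
      ring
  simp only [hs]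
  have hz : Tendsto (fun n => (β⁻¹) ^ n * (betaMap β)^[n] 1) atTop (nhds 0) := by
    have hp := tendsto_pow_atTop_nhds_zero_of_lt_one (inv_nonneg.2 h0.le) (inv_lt_one_of_one_lt₀ hβ)
    refine squeeze_zero (fun n => ?_) (fun n => ?_) hp
    · exact mul_nonneg (by positivity) (betaMap_iterate_mem hβ hβ2 (by simp) n).1.le
    · exact mul_le_of_le_one_right (by positivity) (betaMap_iterate_mem hβ hβ2 (by simp) n).2
  simpa using hz.const_sub 1

/-- The natural extension of the Parry measure, realised on the square. -/
lemma exists_skewMap_invariant_measure {β τ : ℝ} (hβ : 1 < β) (hβ2 : β < 2) (hτ0 : 0 < τ)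
    (hτ : τ < 1 / 2) :
    ∃ ν : Measure (ℝ × ℝ), IsProbabilityMeasure ν ∧ MeasurePreserving (skewMap β τ) ν ν ∧
      ν (Ioc 0 1 ×ˢ Icc 0 1)ᶜ = 0 ∧
      ∃ C : NNReal, ν.map Prod.fst ≤ C • (volume : Measure ℝ).restrict (Ioc 0 1) := by
  have h0 : 0 < β := by linarith
  set a : ℕ → ℝ := fun n => (betaMap β)^[n] 1 with ha
  have ha0 : a 0 = 1 := rfl
  have has (n : ℕ) : a (n + 1) = betaMap β (a n) := Function.iterate_succ_apply' _ _ _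
  have ham (n : ℕ) : a n ∈ Ioc (0 : ℝ) 1 := betaMap_iterate_mem hβ hβ2 (by simp) n
  set g : ℕ → ℝ → ℝ := fun n =>
    Nat.rec id (fun k gk y => τ * gk y + (1 - τ) * betaDigitVal β (a k)) n with hg
  have hg0 : g 0 = id := rfl
  have hgs (n : ℕ) (y : ℝ) : g (n + 1) y = τ * g n y + (1 - τ) * betaDigitVal β (a n) := rfl
  have hgc (n : ℕ) : Continuous (g n) := by
    induction n with
    | zero => exact continuous_id
    | succ n ih => exact (continuous_const.mul ih).add continuous_const
  have hgmono (n : ℕ) : Monotone (g n) := by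
    induction n with
    | zero => exact monotone_id
    | succ n ih =>
      intro x y hxy
      have := mul_le_mul_of_nonneg_left (ih hxy) hτ0.le
      rw [hgs, hgs]; linarith
  have hgmaps (n : ℕ) : MapsTo (g n) (Icc 0 1) (Icc 0 1) := by
    induction n with
    | zero => exact fun x hx => hx
    | succ n ih =>
      intro y hy
      have h1 := ih hy
      have h2 := betaDigitVal_nonneg (β := β) (a n)
      have h3 := betaDigitVal_le_one (β := β) (a n)
      rw [hgs]
      constructor <;> nlinarith [h1.1, h1.2]
  have hp : ∑' n, ENNReal.ofReal (betaDigitVal β (a n) * (β⁻¹) ^ (n + 1)) = 1 := by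
    have hsum := hasSum_betaDigitVal hβ hβ2
    rw [← ENNReal.ofReal_tsum_of_nonneg
      (fun n => mul_nonneg (betaDigitVal_nonneg _) (by positivity)) hsum.summable, hsum.tsum_eq,
      ENNReal.ofReal_one]
  obtain ⟨κ, hκ, hκ1, hκs⟩ := exists_stationary_measure hp (G := fun n y => τ * g n y)
    (fun n => continuous_const.mul (hgc n)) (fun n x y hxy =>
      mul_le_mul_of_nonneg_left (hgmono n hxy) hτ0.le) (fun n y hy => by
      have := hgmaps n hy
      constructor <;> nlinarith [this.1, this.2])
  have hκg (n : ℕ) : IsProbabilityMeasure (κ.map (g n)) :=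
    Measure.isProbabilityMeasure_map (hgc n).aemeasurable
  set ρ : ℝ → Measure ℝ := fun x => volume.restrict (Ioc 0 x) with hρ
  set b : ENNReal := ENNReal.ofReal β⁻¹ with hb
  set N : Measure (ℝ × ℝ) := Measure.sum fun n => b ^ n • (ρ (a n)).prod (κ.map (g n)) with hN
  have hNmap : N.map (skewMap β τ) = N := by
    have hterm (n : ℕ) : (b ^ n • (ρ (a n)).prod (κ.map (g n))).map (skewMap β τ) =
        b ^ (n + 1) • (ρ (a (n + 1))).prod (κ.map (g (n + 1))) +
          (ρ 1).prod (ENNReal.ofReal (betaDigitVal β (a n) * (β⁻¹) ^ (n + 1)) •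
            κ.map (fun y => τ * g n y)) := by
      rw [Measure.map_smul, map_skewMap_prod hβ, ← has, smul_smul, smul_add, smul_smul,
        ← hb, ← pow_succ, Measure.map_map (by fun_prop) (hgc n).measurable,
        Measure.map_map (by fun_prop) (hgc n).measurable, Measure.prod_smul_right,
        ENNReal.ofReal_mul (betaDigitVal_nonneg _), ENNReal.ofReal_pow (by positivity), ← hb,
        mul_comm (b ^ (n + 1))]
      rfl
    rw [hN, Measure.map_sum (measurable_skewMap β τ).aemeasurable]
    simp only [hterm]
    rw [← Measure.sum_add_sum, ← Measure.prod_sum_right, ← hκs]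
    ext s hs
    rw [Measure.add_apply, Measure.sum_apply _ hs, Measure.sum_apply _ hs,
      tsum_eq_zero_add' (f := fun n => (b ^ n • (ρ (a n)).prod (κ.map (g n))) s)
        ENNReal.summable, add_comm]
    simp [ha0, hg0]
  have hNfst : N.map Prod.fst = Measure.sum fun n => b ^ n • ρ (a n) := by
    rw [hN, Measure.map_sum measurable_fst.aemeasurable]
    simp only [Measure.map_smul, Measure.map_fst_prod, measure_univ, one_smul]
  set C : NNReal := (1 - Real.toNNReal β⁻¹)⁻¹ with hC
  have hbC : ∑' n, b ^ n = C := by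
    have hlt : Real.toNNReal β⁻¹ < 1 := by
      rw [Real.toNNReal_lt_one]; exact inv_lt_one_of_one_lt₀ hβ
    rw [ENNReal.tsum_geometric, hC, ENNReal.coe_inv (tsub_pos_of_lt hlt).ne', ENNReal.coe_sub]
    rfl
  have hNle : N.map Prod.fst ≤ C • ρ 1 := by
    rw [hNfst, Measure.le_iff]
    intro s hs
    rw [Measure.sum_apply _ hs]
    calc ∑' n, (b ^ n • ρ (a n)) s ≤ ∑' n, b ^ n * ρ 1 s := by
          refine ENNReal.tsum_le_tsum fun n => ?_
          rw [Measure.smul_apply, smul_eq_mul]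
          gcongr
          exact Measure.restrict_mono (Ioc_subset_Ioc_right (ham n).2) le_rfl
      _ = (C • ρ 1) s := by
          rw [ENNReal.tsum_mul_right, hbC]; rfl
  have hNuniv : N univ = N.map Prod.fst univ := by
    rw [Measure.map_apply measurable_fst .univ, preimage_univ]
  have hN1 : 1 ≤ N univ := by
    rw [hNuniv, hNfst, Measure.sum_apply _ .univ]
    refine le_trans ?_ (ENNReal.le_tsum 0)
    simp [hρ, ha0]
  have hNtop : N univ ≠ ⊤ := by
    rw [hNuniv]
    refine ne_top_of_le_ne_top ?_ (hNle univ)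
    exact measure_ne_top _ _
  have hNsupp : N (Ioc 0 1 ×ˢ Icc 0 1)ᶜ = 0 := by
    have hms : MeasurableSet (Ioc (0 : ℝ) 1 ×ˢ Icc (0 : ℝ) 1)ᶜ :=
      (measurableSet_Ioc.prod measurableSet_Icc).compl
    rw [hN, Measure.sum_apply_eq_zero' hms]
    intro n
    rw [Measure.smul_apply, smul_eq_mul, mul_eq_zero]
    right
    rw [← mem_ae_iff]
    have h1 : ∀ᵐ p ∂((ρ (a n)).prod (κ.map (g n))), p.1 ∈ Ioc 0 (a n) :=
      Measure.quasiMeasurePreserving_fst.ae (ae_restrict_mem measurableSet_Ioc)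
    have h2 : ∀ᵐ y ∂(κ.map (g n)), y ∈ Icc (0 : ℝ) 1 := by
      refine (ae_map_iff (p := (· ∈ Icc (0 : ℝ) 1)) (hgc n).aemeasurable measurableSet_Icc).2 ?_
      have : ∀ᵐ y ∂κ, y ∈ Icc (0 : ℝ) 1 := hκ1
      filter_upwards [this] with y hy using hgmaps n hy
    have h3 : ∀ᵐ p ∂((ρ (a n)).prod (κ.map (g n))), p.2 ∈ Icc (0 : ℝ) 1 :=
      Measure.quasiMeasurePreserving_snd.ae h2
    filter_upwards [h1, h3] with p hp1 hp2
    exact ⟨⟨hp1.1, hp1.2.trans (ham n).2⟩, hp2⟩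
  have hNinv : (N univ)⁻¹ ≤ 1 := ENNReal.inv_le_one.2 hN1
  refine ⟨(N univ)⁻¹ • N, ⟨?_⟩, ⟨measurable_skewMap β τ, ?_⟩, ?_, C, ?_⟩
  · rw [Measure.smul_apply, smul_eq_mul,
      ENNReal.inv_mul_cancel (zero_lt_one.trans_le hN1).ne' hNtop]
  · rw [Measure.map_smul, hNmap]
  · rw [Measure.smul_apply, hNsupp, smul_zero]
  · rw [Measure.map_smul]
    refine le_trans (fun s => ?_) hNle
    rw [Measure.smul_apply, smul_eq_mul]
    exact mul_le_of_le_one_left zero_le hNinv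

lemma injOn_skewMap {β τ : ℝ} (hβ : 0 < β) (hτ0 : 0 < τ) (hτ : τ < 1 / 2) :
    InjOn (skewMap β τ) (Icc 0 1 ×ˢ Icc 0 1) := by
  rintro ⟨x, y⟩ ⟨-, hy⟩ ⟨x', y'⟩ ⟨-, hy'⟩ h
  simp only [mem_Icc] at hy hy'
  have h1 := mul_le_of_le_one_right hτ0.le hy.2
  have h2 := mul_le_of_le_one_right hτ0.le hy'.2
  have h3 := mul_nonneg hτ0.le hy.1
  have h4 := mul_nonneg hτ0.le hy'.1
  have hx : β * x = β * x' → x = x' := mul_left_cancel₀ hβ.ne'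
  have hyy : τ * y = τ * y' → y = y' := mul_left_cancel₀ hτ0.ne'
  unfold skewMap at h
  simp only at h
  split_ifs at h <;> simp only [Prod.mk.injEq] at h ⊢
  · exact ⟨hx h.1, hyy h.2⟩
  · linarith [h.2]
  · linarith [h.2]
  · exact ⟨hx (by linarith [h.1]), hyy (by linarith [h.2])⟩

lemma mapsTo_skewMap {β τ : ℝ} (hβ : 1 < β) (hβ2 : β < 2) (hτ0 : 0 < τ) (hτ : τ < 1 / 2) :
    MapsTo (skewMap β τ) (Icc 0 1 ×ˢ Icc 0 1) (Icc 0 1 ×ˢ Icc 0 1) := by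
  rintro ⟨x, y⟩ ⟨hx, hy⟩
  simp only [mem_Icc] at hx hy
  rw [skewMap_eq]
  refine ⟨?_, ?_⟩
  · rcases hx.1.eq_or_lt with h | h
    · have : (0 : ℝ) ≤ β⁻¹ := inv_nonneg.2 (by linarith)
      simp [betaMap, betaDigitVal, ← h, this]
    · exact Ioc_subset_Icc_self (betaMap_mem hβ hβ2 ⟨h, hx.2⟩)
  · have h2 := betaDigitVal_nonneg (β := β) x
    have h3 := betaDigitVal_le_one (β := β) x
    constructor <;> simp only <;> nlinarith [hy.1, hy.2]

lemma measure_attractor_eq_one {β τ : ℝ} (hβ : 1 < β) (hβ2 : β < 2) (hτ0 : 0 < τ)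
    (hτ : τ < 1 / 2) {ν : Measure (ℝ × ℝ)} [IsProbabilityMeasure ν]
    (hpres : MeasurePreserving (skewMap β τ) ν ν) (hsupp : ν (Ioc 0 1 ×ˢ Icc 0 1)ᶜ = 0) :
    ν (attractor β τ) = 1 := by
  have hI : ∀ᵐ z ∂ν, z ∈ Icc (0 : ℝ) 1 ×ˢ Icc (0 : ℝ) 1 :=
    measure_mono_null (compl_subset_compl.2 (prod_mono_left Ioc_subset_Icc_self)) hsupp
  have hmem : ∀ᵐ z ∂ν, z ∈ ⋂ i : ℕ, (skewMap β τ)^[i] '' (Icc (0 : ℝ) 1 ×ˢ Icc (0 : ℝ) 1) := by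
    simp only [mem_iInter]
    refine ae_all_iff.2 fun i => ?_
    have hm : MeasurableSet ((skewMap β τ)^[i] '' (Icc (0 : ℝ) 1 ×ˢ Icc (0 : ℝ) 1)) :=
      (measurableSet_Icc.prod measurableSet_Icc).image_of_measurable_injOn
        ((measurable_skewMap β τ).iterate i)
        ((injOn_skewMap (by linarith) hτ0 hτ).iterate (mapsTo_skewMap hβ hβ2 hτ0 hτ) i)
    have h2 := (hpres.iterate i).map_eq
    have h3 : ∀ᵐ z ∂(ν.map (skewMap β τ)^[i]),
        z ∈ (skewMap β τ)^[i] '' (Icc (0 : ℝ) 1 ×ˢ Icc (0 : ℝ) 1) := by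
      refine (ae_map_iff (hpres.iterate i).measurable.aemeasurable hm).2 ?_
      exact hI.mono fun z hz => mem_image_of_mem _ hz
    rwa [h2] at h3
  exact (mem_ae_iff_prob_eq_one isClosed_closure.measurableSet).1 (hmem.mono fun z hz => subset_closure hz)

lemma dist_skewMap_iterate_le {β τ : ℝ} (hβ : 1 < β) (hβ2 : β < 2) (hτ0 : 0 < τ) {N : ℕ}
    {z w : ℝ × ℝ} (hz : z ∈ Ioc (0 : ℝ) 1 ×ˢ Icc (0 : ℝ) 1)
    (hw : w ∈ Ioc (0 : ℝ) 1 ×ˢ Icc (0 : ℝ) 1)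
    (h : betaWord β (N + N) z.1 = betaWord β (N + N) w.1) :
    dist ((skewMap β τ)^[N] z) ((skewMap β τ)^[N] w) ≤ max ((β⁻¹) ^ N) (τ ^ N) := by
  have hy {k : ℕ} (hk : k ≤ N + N) :
      ((skewMap β τ)^[k] z).2 - ((skewMap β τ)^[k] w).2 = τ ^ k * (z.2 - w.2) := by
    induction k with
    | zero => simp
    | succ k ih =>
      have h1 := betaDigitVal_eq_of_betaDigit_eq (congrFun h ⟨k, hk⟩)
      rw [Function.iterate_succ_apply', Function.iterate_succ_apply', skewMap_eq, skewMap_eq,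
        fst_skewMap_iterate, fst_skewMap_iterate, pow_succ']
      simp only at h1 ⊢
      rw [h1]
      linear_combination τ * ih (by omega)
  rw [Prod.dist_eq, Real.dist_eq, Real.dist_eq, fst_skewMap_iterate, fst_skewMap_iterate,
    hy (by omega)]
  refine max_le_max ?_ ?_
  · simpa using abs_sub_le_of_betaWord_eq hβ hβ2 hz.1 hw.1 h (k := N) (by omega)
  · rw [abs_mul, abs_of_pos (pow_pos hτ0 N)]
    refine mul_le_of_le_one_right (by positivity) ?_
    rw [abs_le]
    constructor <;> linarith [hz.2.1, hz.2.2, hw.2.1, hw.2.2]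

lemma integrable_comp_betaWord {X : Type*} [MeasurableSpace X] {ν : Measure X} [IsFiniteMeasure ν]
    {π : X → ℝ} (hπ : Measurable π) (β : ℝ) {M : ℕ} (ψ : (Fin M → Fin 2) → ℝ) :
    Integrable (fun z => ψ (betaWord β M (π z))) ν := by
  have hm : Measurable fun z => ψ (betaWord β M (π z)) :=
    (measurable_of_finite ψ).comp ((measurable_betaWord β M).comp hπ)
  obtain ⟨C, hC⟩ := (Set.finite_range fun w => ‖ψ w‖).bddAbove
  exact Integrable.of_bound hm.aestronglyMeasurable C
    (.of_forall fun z => hC ⟨_, rfl⟩)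

/-- Every integrable observable is, after enough iterations, close in mean to a function of
finitely many digits of the first coordinate. -/
lemma exists_betaWord_approx {β τ : ℝ} (hβ : 1 < β) (hβ2 : β < 2) (hτ0 : 0 < τ)
    (hτ : τ < 1 / 2) {ν : Measure (ℝ × ℝ)} [IsProbabilityMeasure ν]
    (hpres : MeasurePreserving (skewMap β τ) ν ν) (hsupp : ν (Ioc 0 1 ×ˢ Icc 0 1)ᶜ = 0)
    {φ : ℝ × ℝ → ℝ} (hφ : Integrable φ ν) {ε : ℝ} (hε : 0 < ε) :
    ∃ (N M : ℕ) (ψ : (Fin M → Fin 2) → ℝ),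
      ∫ z, |φ ((skewMap β τ)^[N] z) - ψ (betaWord β M z.1)| ∂ν ≤ ε := by
  obtain ⟨g, hgs, hg, hgc, hgi⟩ := hφ.exists_hasCompactSupport_integral_sub_le (half_pos hε)
  obtain ⟨δ, hδ, hgδ⟩ := Metric.uniformContinuous_iff.1
    (hgs.uniformContinuous_of_continuous hgc) (ε / 2) (half_pos hε)
  have hlim : Tendsto (fun N : ℕ => max ((β⁻¹) ^ N) (τ ^ N)) atTop (nhds 0) := by
    have h1 := tendsto_pow_atTop_nhds_zero_of_lt_one
      (inv_nonneg.2 (by linarith : (0 : ℝ) ≤ β)) (inv_lt_one_of_one_lt₀ hβ)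
    have h2 := tendsto_pow_atTop_nhds_zero_of_lt_one hτ0.le (by linarith : τ < 1)
    simpa using h1.max h2
  obtain ⟨N, hN⟩ := (hlim.eventually (gt_mem_nhds hδ)).exists
  classical
  set J : Set (ℝ × ℝ) := Ioc 0 1 ×ˢ Icc 0 1 with hJ
  let ψ : (Fin (N + N) → Fin 2) → ℝ := fun w =>
    if h : ∃ z ∈ J, betaWord β (N + N) z.1 = w then g ((skewMap β τ)^[N] h.choose) else 0
  refine ⟨N, N + N, ψ, ?_⟩
  have hψ {z : ℝ × ℝ} (hz : z ∈ J) :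
      |g ((skewMap β τ)^[N] z) - ψ (betaWord β (N + N) z.1)| ≤ ε / 2 := by
    have hex : ∃ z' ∈ J, betaWord β (N + N) z'.1 = betaWord β (N + N) z.1 := ⟨z, hz, rfl⟩
    have : ψ (betaWord β (N + N) z.1) = g ((skewMap β τ)^[N] hex.choose) := dif_pos hex
    rw [this, ← Real.dist_eq]
    exact (hgδ ((dist_skewMap_iterate_le hβ hβ2 hτ0 hz hex.choose_spec.1
      hex.choose_spec.2.symm).trans_lt hN)).le
  have hfN := hpres.iterate N
  have i1 : Integrable (fun z => φ ((skewMap β τ)^[N] z)) ν := hfN.integrable_comp_of_integrable hφ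
  have i2 : Integrable (fun z => g ((skewMap β τ)^[N] z)) ν := hfN.integrable_comp_of_integrable hgi
  have i3 : Integrable (fun z : ℝ × ℝ => ψ (betaWord β (N + N) z.1)) ν :=
    integrable_comp_betaWord measurable_fst β ψ
  calc ∫ z, |φ ((skewMap β τ)^[N] z) - ψ (betaWord β (N + N) z.1)| ∂ν
      ≤ ∫ z, (|φ ((skewMap β τ)^[N] z) - g ((skewMap β τ)^[N] z)| + ε / 2) ∂ν := by
        refine integral_mono_ae (i1.sub i3).abs ((i1.sub i2).abs.add (integrable_const _)) ?_
        have : ∀ᵐ z ∂ν, z ∈ J := mem_ae_iff.2 hsupp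
        filter_upwards [this] with z hz
        exact (abs_sub_le _ (g ((skewMap β τ)^[N] z)) _).trans (by gcongr; exact hψ hz)
    _ = ∫ z, |φ z - g z| ∂ν + ε / 2 := by
        have i4 : Integrable
            (fun z => |φ ((skewMap β τ)^[N] z) - g ((skewMap β τ)^[N] z)|) ν := (i1.sub i2).abs
        rw [integral_add i4 (integrable_const _)]
        congr 1
        · conv_rhs => rw [← hfN.map_eq]
          rw [integral_map hfN.measurable.aemeasurable]
          rw [hfN.map_eq]
          exact (hφ.sub hgi).abs.aestronglyMeasurable
        · simp
    _ ≤ ε := by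
        have : ∫ z, |φ z - g z| ∂ν ≤ ε / 2 := hg
        linarith

lemma measurePreserving_betaMap_fst {β τ : ℝ} {ν : Measure (ℝ × ℝ)}
    (hpres : MeasurePreserving (skewMap β τ) ν ν) :
    MeasurePreserving (betaMap β) (ν.map Prod.fst) (ν.map Prod.fst) := by
  refine ⟨measurable_betaMap β, ?_⟩
  have hc : betaMap β ∘ Prod.fst = Prod.fst ∘ skewMap β τ := by
    funext p; simp [skewMap_eq]
  rw [Measure.map_map (measurable_betaMap β) measurable_fst, hc,
    ← Measure.map_map measurable_fst (measurable_skewMap β τ), hpres.map_eq]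

lemma ergodic_skewMap {β τ : ℝ} (hβ : 1 < β) (hβ2 : β < 2) (hτ0 : 0 < τ) (hτ : τ < 1 / 2)
    {ν : Measure (ℝ × ℝ)} [IsProbabilityMeasure ν]
    (hpres : MeasurePreserving (skewMap β τ) ν ν) (hsupp : ν (Ioc 0 1 ×ˢ Icc 0 1)ᶜ = 0)
    (hac : ν.map Prod.fst ≪ volume.restrict (Ioc 0 1)) :
    Ergodic (skewMap β τ) ν := by
  refine ⟨hpres, ⟨fun A hA hinv => ?_⟩⟩
  have hfst : Measurable (Prod.fst : ℝ × ℝ → ℝ) := measurable_fst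
  have hpresA : MeasurePreserving (skewMap β τ) (ν.restrict A) (ν.restrict A) := by
    have := hpres.restrict_preimage hA
    rwa [hinv] at this
  have hacA : (ν.restrict A).map Prod.fst ≪ ν.map Prod.fst :=
    (Measure.absolutelyContinuous_of_le Measure.restrict_le_self).map hfst
  obtain ⟨c, hc⟩ := (ergodic_betaMap hβ hβ2 (measurePreserving_betaMap_fst hpres)
    hac).eq_smul_of_absolutelyContinuous (measurePreserving_betaMap_fst hpresA) hacA
  have hcA : c = ν A := by
    have := congrArg (fun μ : Measure ℝ => μ univ) hc
    simpa [Measure.map_apply hfst] using this.symm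
  set t := ν.real A with ht
  have ht0 : 0 ≤ t := measureReal_nonneg
  have ht1 : t ≤ 1 := measureReal_le_one
  have hiter (N : ℕ) : (skewMap β τ)^[N] ⁻¹' A = A := by
    induction N with
    | zero => rfl
    | succ N ih => rw [Function.iterate_succ, preimage_comp, ih, hinv]
  have hφ : Integrable (A.indicator fun _ => (1 : ℝ)) ν := (integrable_const 1).indicator hA
  have hbound {ε : ℝ} (hε : 0 < ε) : |t - t ^ 2| ≤ 2 * ε := by
    obtain ⟨N, M, ψ, h⟩ := exists_betaWord_approx hβ hβ2 hτ0 hτ hpres hsupp hφ hε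
    have hcomp (z : ℝ × ℝ) : A.indicator (fun _ => (1 : ℝ)) ((skewMap β τ)^[N] z) =
        A.indicator (fun _ => (1 : ℝ)) z := by
      have : (skewMap β τ)^[N] z ∈ A ↔ z ∈ A := by
        rw [← mem_preimage, hiter N]
      by_cases hz : z ∈ A
      · rw [indicator_of_mem hz, indicator_of_mem (this.2 hz)]
      · rw [indicator_of_notMem hz, indicator_of_notMem (mt this.1 hz)]
    simp only [hcomp] at h
    have hψ : Integrable (fun z : ℝ × ℝ => ψ (betaWord β M z.1)) ν :=
      integrable_comp_betaWord hfst β ψ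
    set S := ∫ z, ψ (betaWord β M z.1) ∂ν with hS
    have hψm : Measurable fun x => ψ (betaWord β M x) :=
      (measurable_of_finite ψ).comp (measurable_betaWord β M)
    have hSA : ∫ z in A, ψ (betaWord β M z.1) ∂ν = t * S := by
      have h1 : ∫ z in A, ψ (betaWord β M z.1) ∂ν =
          ∫ x, ψ (betaWord β M x) ∂((ν.restrict A).map Prod.fst) :=
        (integral_map hfst.aemeasurable hψm.aestronglyMeasurable).symm
      rw [h1, hc, integral_smul_measure,
        integral_map hfst.aemeasurable hψm.aestronglyMeasurable, hcA]
      rfl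
    have e1 : |t - S| ≤ ε := by
      have : t - S = ∫ z, (A.indicator (fun _ => (1 : ℝ)) z - ψ (betaWord β M z.1)) ∂ν := by
        rw [integral_sub hφ hψ, integral_indicator hA]
        simp [ht, hS]
      rw [this]
      exact (abs_integral_le_integral_abs).trans h
    have e2 : |t - t * S| ≤ ε := by
      have : t - t * S =
          ∫ z in A, (A.indicator (fun _ => (1 : ℝ)) z - ψ (betaWord β M z.1)) ∂ν := by
        rw [integral_sub hφ.integrableOn hψ.integrableOn, hSA, setIntegral_indicator hA]
        simp [ht]
      rw [this]
      exact (abs_integral_le_integral_abs).trans ((setIntegral_le_integral (hφ.sub hψ).abs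
        (.of_forall fun z => abs_nonneg _)).trans h)
    rw [abs_le] at e1 e2 ⊢
    constructor <;> nlinarith [e1.1, e1.2, e2.1, e2.2]
  have hzero : t - t ^ 2 = 0 := by
    by_contra hne
    have := hbound (ε := |t - t ^ 2| / 4) (by positivity)
    have := abs_pos.2 hne
    linarith
  rw [eventuallyConst_set']
  have hmul : t * (1 - t) = 0 := by linarith
  rcases mul_eq_zero.1 hmul with h | h
  · left
    exact ae_eq_empty.2 ((measureReal_eq_zero_iff).1 h)
  · right
    refine eventuallyEq_univ.2 (mem_ae_iff.2 ?_)
    rw [prob_compl_eq_zero_iff hA]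
    have : ν.real A = 1 := by linarith
    rw [measureReal_def] at this
    exact (ENNReal.toReal_eq_one_iff _).1 this

section entropy

variable {α : Type*} [Fintype α] [MeasurableSpace α] [MeasurableSingletonClass α]

lemma sum_measureReal_singleton_eq_one (P : Measure α) [IsProbabilityMeasure P] :
    ∑ a, P.real {a} = 1 := by
  rw [sum_measureReal_singleton]
  simp

/-- Gibbs' inequality. -/
lemma finEntropy_le_of_sum_le_one (P : Measure α) [IsProbabilityMeasure P] {Q : α → ℝ}
    (hQ : ∀ a, 0 < Q a) (hQ1 : ∑ a, Q a ≤ 1) :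
    finEntropy P ≤ ∑ a, P.real {a} * -Real.log (Q a) := by
  have h (a : α) : P.real {a} * Real.log (Q a) - P.real {a} * Real.log (P.real {a}) ≤
      Q a - P.real {a} := by
    rcases (measureReal_nonneg (μ := P) (s := {a})).eq_or_lt' with h0 | h0
    · simp [h0, (hQ a).le]
    · have := Real.log_le_sub_one_of_pos (div_pos (hQ a) h0)
      rw [Real.log_div (hQ a).ne' h0.ne'] at this
      calc _ = P.real {a} * (Real.log (Q a) - Real.log (P.real {a})) := by ring
        _ ≤ P.real {a} * (Q a / P.real {a} - 1) := mul_le_mul_of_nonneg_left this h0.le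
        _ = _ := by field_simp
  have hsum := Finset.sum_le_sum fun a (_ : a ∈ Finset.univ) => h a
  simp only [Finset.sum_sub_distrib, sum_measureReal_singleton_eq_one] at hsum
  simp only [finEntropy, ← measureReal_def, mul_neg, Finset.sum_neg_distrib]
  linarith

lemma finEntropy_map_le_integral {X : Type*} [MeasurableSpace X] (μ : Measure X)
    [IsProbabilityMeasure μ] {V : X → α} (hV : Measurable V) {Q : α → ℝ}
    (hQ : ∀ a, 0 < Q a) (hQ1 : ∑ a, Q a ≤ 1) :
    finEntropy (μ.map V) ≤ ∫ x, -Real.log (Q (V x)) ∂μ := by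
  have : IsProbabilityMeasure (μ.map V) := Measure.isProbabilityMeasure_map hV.aemeasurable
  refine (finEntropy_le_of_sum_le_one _ hQ hQ1).trans_eq ?_
  rw [← integral_map (f := fun a => -Real.log (Q a)) hV.aemeasurable
    (measurable_of_finite _).aestronglyMeasurable, integral_fintype (.of_finite)]
  rfl

lemma neg_log_le_finEntropy (P : Measure α) [IsProbabilityMeasure P] {c : ℝ}
    (hc : ∀ a, P.real {a} ≤ c) : -Real.log c ≤ finEntropy P := by
  have h (a : α) : P.real {a} * Real.log (P.real {a}) ≤ P.real {a} * Real.log c := by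
    rcases (measureReal_nonneg (μ := P) (s := {a})).eq_or_lt' with h0 | h0
    · simp [h0]
    · exact mul_le_mul_of_nonneg_left (Real.log_le_log h0 (hc a)) h0.le
  have hsum := Finset.sum_le_sum fun a (_ : a ∈ Finset.univ) => h a
  rw [← Finset.sum_mul, sum_measureReal_singleton_eq_one, one_mul] at hsum
  simp only [finEntropy, ← measureReal_def]
  linarith

end entropy

/-- A word observable that is close in Hamming distance to one taking few values has small
entropy. -/
lemma finEntropy_map_le_of_hamming {X : Type*} [MeasurableSpace X] (μ : Measure X)
    [IsProbabilityMeasure μ] {n m : ℕ} {V U : X → Fin n → Fin m} (hV : Measurable V)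
    (hU : Measurable U) {R : Finset (Fin n → Fin m)} (hR : ∀ᵐ x ∂μ, U x ∈ R) {η L : ℝ}
    (hηL : Real.exp (-η) * (1 + m * Real.exp (-L)) ≤ 1) :
    finEntropy (μ.map V) ≤
      Real.log R.card + n * η + L * ∑ i, μ.real {x | V x i ≠ U x i} := by
  classical
  obtain ⟨x₀, hx₀⟩ := hR.exists
  have hR0 : (0 : ℝ) < R.card := by exact_mod_cast Finset.card_pos.2 ⟨_, hx₀⟩
  set k : Fin m → Fin m → ℝ := fun a b => Real.exp (-(η + if b ≠ a then L else 0)) with hk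
  have hk1 (a : Fin m) : ∑ b, k a b ≤ 1 := by
    refine le_trans ?_ hηL
    have hle (b : Fin m) :
        k a b ≤ Real.exp (-η) * ((if b = a then 1 else 0) + Real.exp (-L)) := by
      simp only [hk, neg_add, Real.exp_add]
      by_cases hb : b = a
      · simp [hb, Real.exp_pos, Real.exp_nonneg]
      · simp [hb]
    refine (Finset.sum_le_sum fun b _ => hle b).trans_eq ?_
    rw [← Finset.mul_sum, Finset.sum_add_distrib]
    simp
  set Q : (Fin n → Fin m) → ℝ := fun v => (R.card : ℝ)⁻¹ * ∑ u ∈ R, ∏ i, k (u i) (v i) with hQ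
  have hQ0 (v) : 0 < Q v :=
    mul_pos (inv_pos.2 hR0) (Finset.sum_pos
      (fun u _ => Finset.prod_pos fun i _ => Real.exp_pos _) ⟨_, hx₀⟩)
  have hQ1 : ∑ v, Q v ≤ 1 := by
    rw [← Finset.mul_sum, Finset.sum_comm, inv_mul_le_iff₀ hR0, mul_one]
    calc _ ≤ ∑ u ∈ R, (1 : ℝ) := by
          refine Finset.sum_le_sum fun u _ => ?_
          rw [← Fintype.piFinset_univ, ← Finset.prod_univ_sum]
          exact Finset.prod_le_one (fun i _ => Finset.sum_nonneg fun b _ => (Real.exp_pos _).le)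
            fun i _ => hk1 (u i)
      _ = _ := by simp
  have hms (i : Fin n) : MeasurableSet {x | V x i ≠ U x i} :=
    (measurableSet_eq_fun ((measurable_pi_apply i).comp hV)
      ((measurable_pi_apply i).comp hU)).compl
  have hint (i : Fin n) : Integrable ({x | V x i ≠ U x i}.indicator fun _ => L) μ :=
    (integrable_const L).indicator (hms i)
  have hbound : ∀ᵐ x ∂μ, -Real.log (Q (V x)) ≤
      (Real.log R.card + n * η) + ∑ i, {x | V x i ≠ U x i}.indicator (fun _ => L) x := by
    filter_upwards [hR] with x hx
    have h1 : (R.card : ℝ)⁻¹ * ∏ i, k (U x i) (V x i) ≤ Q (V x) :=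
      mul_le_mul_of_nonneg_left (Finset.single_le_sum
        (f := fun u => ∏ i, k (u i) (V x i))
        (fun u _ => Finset.prod_nonneg fun i _ => (Real.exp_pos _).le) hx) (inv_pos.2 hR0).le
    have h2 : 0 < ∏ i, k (U x i) (V x i) := Finset.prod_pos fun i _ => Real.exp_pos _
    have h3 := Real.log_le_log (mul_pos (inv_pos.2 hR0) h2) h1
    rw [Real.log_mul (inv_pos.2 hR0).ne' h2.ne', Real.log_inv,
      Real.log_prod (fun i _ => (Real.exp_pos _).ne')] at h3
    simp only [Real.log_exp, Finset.sum_neg_distrib, Finset.sum_add_distrib,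
      Finset.sum_const, Finset.card_univ, Fintype.card_fin, nsmul_eq_mul] at h3
    simp only [indicator_apply, mem_ofPred_eq]
    linarith
  refine (finEntropy_map_le_integral μ hV hQ0 hQ1).trans ?_
  refine (integral_mono_ae ?_ ?_ hbound).trans_eq ?_
  · exact Integrable.of_finite (f := fun v => -Real.log (Q v)) (μ := μ.map V) |>.comp_measurable hV
  · exact (integrable_const _).add (integrable_finsetSum _ fun i _ => hint i)
  · rw [integral_add (integrable_const _) (integrable_finsetSum _ fun i _ => hint i),
      integral_finsetSum _ fun i _ => hint i]
    simp [integral_indicator, hms, Finset.mul_sum, mul_comm]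

section entropyBounds

variable {β τ : ℝ} {ν : Measure (ℝ × ℝ)}

lemma measurable_skewMap_itinerary (β τ : ℝ) {m : ℕ} {p : ℝ × ℝ → Fin m} (hp : Measurable p)
    (n : ℕ) : Measurable fun (z : ℝ × ℝ) (i : Fin n) => p ((skewMap β τ)^[i] z) :=
  measurable_pi_lambda _ fun i => hp.comp ((measurable_skewMap β τ).iterate i)

lemma le_finEntropy_betaDigit [IsProbabilityMeasure ν] (hβ : 1 < β) (hβ2 : β < 2) {C : NNReal}
    (hC : ν.map Prod.fst ≤ C • (volume : Measure ℝ).restrict (Ioc 0 1)) (n : ℕ) :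
    n * Real.log β - Real.log (C + 1) ≤ finEntropy (ν.map fun (z : ℝ × ℝ) (i : Fin n) =>
      betaDigit β ((skewMap β τ)^[i] z).1) := by
  have h0 : 0 < β := by linarith
  have hm : Measurable fun (z : ℝ × ℝ) (i : Fin n) => betaDigit β ((skewMap β τ)^[i] z).1 :=
    measurable_skewMap_itinerary β τ ((measurable_betaDigit β).comp measurable_fst) n
  have : IsProbabilityMeasure
      (ν.map fun (z : ℝ × ℝ) (i : Fin n) => betaDigit β ((skewMap β τ)^[i] z).1) :=
    Measure.isProbabilityMeasure_map hm.aemeasurable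
  have key : n * Real.log β - Real.log (C + 1) = -Real.log ((C + 1) * (β⁻¹) ^ n) := by
    rw [Real.log_mul (by positivity) (by positivity), Real.log_pow, Real.log_inv]
    ring
  rw [key]
  refine neg_log_le_finEntropy _ fun w => ?_
  have hpre : (fun (z : ℝ × ℝ) (i : Fin n) => betaDigit β ((skewMap β τ)^[i] z).1) ⁻¹' {w} =
      Prod.fst ⁻¹' (betaWord β n ⁻¹' {w}) := by
    simp only [fst_skewMap_iterate]
    rfl
  have hmw : MeasurableSet (betaWord β n ⁻¹' {w}) :=
    measurable_betaWord β n (measurableSet_singleton w)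
  rw [measureReal_def, Measure.map_apply hm (measurableSet_singleton w), hpre,
    ← Measure.map_apply measurable_fst hmw]
  refine ENNReal.toReal_le_of_le_ofReal (by positivity) ((hC _).trans ?_)
  rw [Measure.smul_apply, Measure.restrict_apply hmw]
  have hdiam : volume (betaWord β n ⁻¹' {w} ∩ Ioc 0 1) ≤ ENNReal.ofReal ((β⁻¹) ^ n) := by
    refine (Real.volume_le_diam _).trans (Metric.ediam_le fun x hx y hy => ?_)
    rw [edist_dist]
    refine ENNReal.ofReal_le_ofReal ?_
    simpa [Real.dist_eq] using abs_sub_le_of_betaWord_eq hβ hβ2 hx.2 hy.2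
      ((mem_singleton_iff.1 hx.1).trans (mem_singleton_iff.1 hy.1).symm) (Nat.zero_le n)
  calc C • volume (betaWord β n ⁻¹' {w} ∩ Ioc 0 1)
      ≤ C • ENNReal.ofReal ((β⁻¹) ^ n) := by gcongr
    _ = ENNReal.ofReal (C * (β⁻¹) ^ n) := by
      rw [ENNReal.ofReal_mul C.coe_nonneg, ENNReal.ofReal_coe_nnreal]
      rfl
    _ ≤ _ := by
      gcongr
      linarith

lemma log_ncard_betaWord_image_le (hβ : 1 < β) (hβ2 : β < 2) (n : ℕ) :
    Real.log (betaWord β n '' Ioc 0 1).ncard ≤ Real.log (β / (β - 1)) + n * Real.log β := by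
  have h0 : 0 < β := by linarith
  have h1 : 0 < β - 1 := by linarith
  rw [← Real.log_pow, ← Real.log_mul (by positivity) (by positivity)]
  refine Real.log_le_log ?_ ?_
  · exact_mod_cast (Set.ncard_pos (toFinite _)).2 ((nonempty_Ioc.2 zero_lt_one).image _)
  · refine (ncard_betaWord_image_le hβ hβ2 n (by simp)).trans ?_
    have : β / (β - 1) * β ^ n - (β * (β ^ n - 1) / (β - 1) * 1 + 1) = 1 / (β - 1) := by
      field_simp
      ring
    have h2 : 0 < 1 / (β - 1) := by positivity
    linarith

lemma exists_betaWord_observable [IsProbabilityMeasure ν] (hβ : 1 < β) (hβ2 : β < 2)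
    (hτ0 : 0 < τ) (hτ : τ < 1 / 2) (hpres : MeasurePreserving (skewMap β τ) ν ν)
    (hsupp : ν (Ioc 0 1 ×ˢ Icc 0 1)ᶜ = 0) {m : ℕ} {p : ℝ × ℝ → Fin m} (hp : Measurable p)
    {ε : ℝ} (hε : 0 < ε) :
    ∃ (N M : ℕ) (r : (Fin M → Fin 2) → Fin m),
      ν.real {z | p ((skewMap β τ)^[N] z) ≠ r (betaWord β M z.1)} ≤ ε := by
  classical
  set φ : ℝ × ℝ → ℝ := fun z => ((p z : ℕ) : ℝ) with hφ
  have hφi : Integrable φ ν :=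
    (Integrable.of_finite (f := fun j : Fin m => ((j : ℕ) : ℝ)) (μ := ν.map p)).comp_measurable hp
  obtain ⟨N, M, ψ, h⟩ := exists_betaWord_approx hβ hβ2 hτ0 hτ hpres hsupp hφi (half_pos hε)
  set r : (Fin M → Fin 2) → Fin m := fun w =>
    if h : ∃ j : Fin m, |((j : ℕ) : ℝ) - ψ w| < 1 / 2 then h.choose else p 0 with hr
  refine ⟨N, M, r, ?_⟩
  have hsub : {z | p ((skewMap β τ)^[N] z) ≠ r (betaWord β M z.1)} ⊆
      {z | 1 / 2 ≤ |φ ((skewMap β τ)^[N] z) - ψ (betaWord β M z.1)|} := by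
    intro z hz
    by_contra hlt
    rw [mem_ofPred_eq, not_le] at hlt
    have hex : ∃ j : Fin m, |((j : ℕ) : ℝ) - ψ (betaWord β M z.1)| < 1 / 2 := ⟨_, hlt⟩
    refine hz ?_
    have hc := hex.choose_spec
    have hrv : r (betaWord β M z.1) = hex.choose := by
      rw [hr]
      exact dif_pos hex
    rw [hrv]
    simp only [hφ] at hlt
    rw [abs_lt] at hlt hc
    have h1 : (((p ((skewMap β τ)^[N] z) : ℕ) : ℤ) : ℝ) < ((hex.choose : ℕ) : ℤ) + 1 := by
      push_cast; linarith [hlt.1, hlt.2, hc.1, hc.2]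
    have h2 : (((hex.choose : ℕ) : ℤ) : ℝ) < ((p ((skewMap β τ)^[N] z) : ℕ) : ℤ) + 1 := by
      push_cast; linarith [hlt.1, hlt.2, hc.1, hc.2]
    norm_cast at h1 h2
    exact Fin.ext (by omega)
  have hint : Integrable
      (fun z => |φ ((skewMap β τ)^[N] z) - ψ (betaWord β M z.1)|) ν :=
    (((hpres.iterate N).integrable_comp_of_integrable hφi).sub
      (integrable_comp_betaWord measurable_fst β ψ)).abs
  have hmarkov := mul_meas_ge_le_integral_of_nonneg
    (Eventually.of_forall fun z => abs_nonneg _) hint (1 / 2)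
  have := measureReal_mono hsub (μ := ν)
  linarith

lemma finEntropy_itinerary_le [IsProbabilityMeasure ν] (hβ : 1 < β) (hβ2 : β < 2)
    (hτ0 : 0 < τ) (hτ : τ < 1 / 2) (hpres : MeasurePreserving (skewMap β τ) ν ν)
    (hsupp : ν (Ioc 0 1 ×ˢ Icc 0 1)ᶜ = 0) {m : ℕ} {p : ℝ × ℝ → Fin m} (hp : Measurable p)
    {δ : ℝ} (hδ : 0 < δ) :
    ∃ c : ℝ, ∀ n : ℕ, finEntropy (ν.map fun (z : ℝ × ℝ) (i : Fin n) => p ((skewMap β τ)^[i] z)) ≤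
      c + n * (Real.log β + δ) := by
  classical
  obtain ⟨L, hL0, hL⟩ : ∃ L : ℝ, 0 ≤ L ∧
      Real.exp (-(δ / 2)) * (1 + m * Real.exp (-L)) ≤ 1 := by
    have hlim : Tendsto (fun L : ℝ => Real.exp (-(δ / 2)) * (1 + m * Real.exp (-L))) atTop
        (nhds (Real.exp (-(δ / 2)) * (1 + m * 0))) :=
      ((Real.tendsto_exp_neg_atTop_nhds_zero.const_mul _).const_add _).const_mul _
    have hlt : Real.exp (-(δ / 2)) * (1 + m * 0) < 1 := by
      rw [mul_zero, add_zero, mul_one, Real.exp_lt_one_iff]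
      linarith
    obtain ⟨L, h1, h2⟩ := ((eventually_ge_atTop 0).and (hlim.eventually_le_const hlt)).exists
    exact ⟨L, h1, h2⟩
  obtain ⟨N, M, r, hr⟩ := exists_betaWord_observable hβ hβ2 hτ0 hτ hpres hsupp hp
    (ε := δ / (2 * (L + 1))) (by positivity)
  refine ⟨Real.log (β / (β - 1)) + M * Real.log β, fun n => ?_⟩
  set V : ℝ × ℝ → Fin n → Fin m := fun z i => p ((skewMap β τ)^[i] z) with hV
  have hVm : Measurable V := measurable_skewMap_itinerary β τ hp n
  have hVN := (hpres.iterate N)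
  have hlaw : ν.map V = ν.map (V ∘ (skewMap β τ)^[N]) := by
    rw [← Measure.map_map hVm hVN.measurable, hVN.map_eq]
  set q : ℝ × ℝ → Fin m := fun z => r (betaWord β M z.1) with hq
  have hqm : Measurable q :=
    (measurable_of_finite r).comp ((measurable_betaWord β M).comp measurable_fst)
  set U : ℝ × ℝ → Fin n → Fin m := fun z i => q ((skewMap β τ)^[i] z) with hU
  set g : (Fin (n + M) → Fin 2) → Fin n → Fin m := fun w i =>
    r fun j : Fin M => w ⟨i + j, by omega⟩ with hg
  set W := betaWord β (n + M) '' Ioc 0 1 with hW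
  have hUg (z : ℝ × ℝ) : U z = g (betaWord β (n + M) z.1) := by
    funext i
    simp only [hU, hq, hg, fst_skewMap_iterate]
    congr 1
    funext j
    simp only [betaWord]
    rw [add_comm, Function.iterate_add_apply]
  have hR : ∀ᵐ z ∂ν, U z ∈ W.toFinset.image g := by
    have hae : ∀ᵐ z ∂ν, z ∈ Ioc (0 : ℝ) 1 ×ˢ Icc (0 : ℝ) 1 := hsupp
    filter_upwards [hae] with z hz
    rw [hUg]
    exact Finset.mem_image_of_mem _ (mem_toFinset.2 (mem_image_of_mem _ hz.1))
  have hcard : Real.log (W.toFinset.image g).card ≤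
      Real.log (β / (β - 1)) + (n + M : ℕ) * Real.log β := by
    refine le_trans (Real.log_le_log ?_ ?_) (log_ncard_betaWord_image_le hβ hβ2 (n + M))
    · obtain ⟨z, hz⟩ := hR.exists
      exact_mod_cast Finset.card_pos.2 ⟨_, hz⟩
    · rw [ncard_eq_toFinset_card']
      exact_mod_cast Finset.card_image_le
  have hdist (i : Fin n) :
      ν.real {z | (V ∘ (skewMap β τ)^[N]) z i ≠ U z i} ≤ δ / (2 * (L + 1)) := by
    have hset : {z | (V ∘ (skewMap β τ)^[N]) z i ≠ U z i} =
        (skewMap β τ)^[i] ⁻¹' {z | p ((skewMap β τ)^[N] z) ≠ q z} := by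
      ext z
      simp only [hV, hU, Function.comp_apply, mem_ofPred_eq, mem_preimage,
        ← Function.iterate_add_apply]
      rw [add_comm]
    have hms : MeasurableSet {z | p ((skewMap β τ)^[N] z) ≠ q z} :=
      (measurableSet_eq_fun (hp.comp hVN.measurable) hqm).compl
    rw [hset, (hpres.iterate i).measureReal_preimage hms.nullMeasurableSet]
    exact hr
  have hmain := finEntropy_map_le_of_hamming ν (hVm.comp hVN.measurable)
    (measurable_skewMap_itinerary β τ hqm n) hR hL
  have hsum : L * ∑ i, ν.real {z | (V ∘ (skewMap β τ)^[N]) z i ≠ U z i} ≤ n * (δ / 2) := by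
    calc _ ≤ L * ∑ _i : Fin n, δ / (2 * (L + 1)) := by
          gcongr with i
          exact hdist i
      _ = n * (δ / 2) * (L / (L + 1)) := by
          simp only [Finset.sum_const, Finset.card_univ, Fintype.card_fin, nsmul_eq_mul]
          field_simp
      _ ≤ n * (δ / 2) := mul_le_of_le_one_right (by positivity)
          ((div_le_one (by positivity)).2 (by linarith))
  rw [hlaw]
  push_cast at hcard
  linarith

lemma tendsto_const_div_add (c a : ℝ) :
    Tendsto (fun n : ℕ => c / n + a) atTop (nhds a) := by
  simpa using (tendsto_const_div_atTop_nhds_zero_nat c).add_const a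

lemma obsEntropy_le [IsProbabilityMeasure ν] (hβ : 1 < β) (hβ2 : β < 2)
    (hτ0 : 0 < τ) (hτ : τ < 1 / 2) (hpres : MeasurePreserving (skewMap β τ) ν ν)
    (hsupp : ν (Ioc 0 1 ×ˢ Icc 0 1)ᶜ = 0) {m : ℕ} {p : ℝ × ℝ → Fin m} (hp : Measurable p) :
    obsEntropy ν (skewMap β τ) p ≤ Real.log β := by
  refine le_of_forall_pos_le_add fun δ hδ => ?_
  obtain ⟨c, hc⟩ := finEntropy_itinerary_le hβ hβ2 hτ0 hτ hpres hsupp hp hδ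
  have hlim := tendsto_const_div_add c (Real.log β + δ)
  rw [← hlim.liminf_eq]
  refine liminf_le_liminf ?_ ?_ hlim.isCoboundedUnder_ge
  · filter_upwards [eventually_gt_atTop 0] with n hn
    have hn' : (0 : ℝ) < n := by exact_mod_cast hn
    rw [div_le_iff₀ hn']
    refine (hc n).trans_eq ?_
    field_simp
  · refine isBoundedUnder_of ⟨0, fun n => div_nonneg ?_ n.cast_nonneg⟩
    have : IsProbabilityMeasure
        (ν.map fun (z : ℝ × ℝ) (i : Fin n) => p ((skewMap β τ)^[i] z)) :=
      Measure.isProbabilityMeasure_map (measurable_skewMap_itinerary β τ hp n).aemeasurable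
    simpa using neg_log_le_finEntropy
      (ν.map fun (z : ℝ × ℝ) (i : Fin n) => p ((skewMap β τ)^[i] z))
      (fun w => measureReal_le_one)

lemma le_obsEntropy_betaDigit [IsProbabilityMeasure ν] (hβ : 1 < β) (hβ2 : β < 2)
    (hτ0 : 0 < τ) (hτ : τ < 1 / 2) (hpres : MeasurePreserving (skewMap β τ) ν ν)
    (hsupp : ν (Ioc 0 1 ×ˢ Icc 0 1)ᶜ = 0) {C : NNReal}
    (hC : ν.map Prod.fst ≤ C • (volume : Measure ℝ).restrict (Ioc 0 1)) :
    Real.log β ≤ obsEntropy ν (skewMap β τ) fun z => betaDigit β z.1 := by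
  have hp : Measurable fun z : ℝ × ℝ => betaDigit β z.1 :=
    (measurable_betaDigit β).comp measurable_fst
  obtain ⟨c, hc⟩ := finEntropy_itinerary_le hβ hβ2 hτ0 hτ hpres hsupp hp one_pos
  have hlim := tendsto_const_div_add (-Real.log (C + 1)) (Real.log β)
  have hlim' := tendsto_const_div_add c (Real.log β + 1)
  rw [← hlim.liminf_eq]
  refine liminf_le_liminf ?_ hlim.isBoundedUnder_ge ?_
  · filter_upwards [eventually_gt_atTop 0] with n hn
    have hn' : (0 : ℝ) < n := by exact_mod_cast hn
    rw [le_div_iff₀ hn']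
    refine le_trans (le_of_eq ?_) (le_finEntropy_betaDigit hβ hβ2 hC n)
    field_simp
    ring
  · refine IsBoundedUnder.isCoboundedUnder_ge (hlim'.isBoundedUnder_le.mono_le ?_)
    filter_upwards [eventually_gt_atTop 0] with n hn
    have hn' : (0 : ℝ) < n := by exact_mod_cast hn
    rw [div_le_iff₀ hn']
    refine (hc n).trans_eq ?_
    field_simp

lemma metricEntropy_skewMap [IsProbabilityMeasure ν] (hβ : 1 < β) (hβ2 : β < 2)
    (hτ0 : 0 < τ) (hτ : τ < 1 / 2) (hpres : MeasurePreserving (skewMap β τ) ν ν)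
    (hsupp : ν (Ioc 0 1 ×ˢ Icc 0 1)ᶜ = 0) {C : NNReal}
    (hC : ν.map Prod.fst ≤ C • (volume : Measure ℝ).restrict (Ioc 0 1)) :
    metricEntropy ν (skewMap β τ) = Real.log β := by
  have hp : Measurable fun z : ℝ × ℝ => betaDigit β z.1 :=
    (measurable_betaDigit β).comp measurable_fst
  refine IsGreatest.csSup_eq ⟨⟨2, _, hp, ?_⟩, ?_⟩
  · exact (le_obsEntropy_betaDigit hβ hβ2 hτ0 hτ hpres hsupp hC).antisymm
      (obsEntropy_le hβ hβ2 hτ0 hτ hpres hsupp hp)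
  · rintro h ⟨m, p, hpm, rfl⟩
    exact obsEntropy_le hβ hβ2 hτ0 hτ hpres hsupp hpm

end entropyBounds

/-- There exists an `f`-ergodic Borel probability measure on `Λ_{β,τ}` of maximal
entropy `log β`. -/
theorem stmt15 (β τ : ℝ) (hβ : 1 < β) (hβ2 : β < 2) (hτ0 : 0 < τ) (hτ : τ < 1 / 2) :
    ∃ ν : Measure (ℝ × ℝ), IsProbabilityMeasure ν ∧ ν (attractor β τ) = 1 ∧
      Ergodic (skewMap β τ) ν ∧ metricEntropy ν (skewMap β τ) = Real.log β := by
  obtain ⟨ν, hν, hpres, hsupp, C, hC⟩ := exists_skewMap_invariant_measure hβ hβ2 hτ0 hτ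
  have hac : ν.map Prod.fst ≪ (volume : Measure ℝ).restrict (Ioc 0 1) :=
    (Measure.absolutelyContinuous_of_le hC).trans Measure.smul_absolutelyContinuous
  exact ⟨ν, hν, measure_attractor_eq_one hβ hβ2 hτ0 hτ hpres hsupp,
    ergodic_skewMap hβ hβ2 hτ0 hτ hpres hsupp hac,
    metricEntropy_skewMap hβ hβ2 hτ0 hτ hpres hsupp hC⟩
end
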